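/- arXiv:2003.14389 — 6 statements merged into one kernel-verified Lean document; each statement's English description precedes it below -/
import Mathlib

section
/- (Theorem 1, sign recovery by the ℓ2 stage.) Let m ≤ n and let Ā ∈ ℝ^{m×n} with Ā = B·Q, where B ∈ ℝ^{m×m} is invertible and Q ∈ ℝ^{m×n} satisfies Q·Qᵀ = I_m. Let x̃ ∈ ℝ^n be supported on S ⊆ {1,…,n} (i.e., x̃_i = 0 for i ∉ S), and let 0 < c ≤ |x̃_i| ≤ d for all i ∈ S. Let e ∈ ℝ^m, ȳ := Ā·x̃ + e, z := Āᵀ·(Ā·Āᵀ)⁻¹·ȳ, and f := Āᵀ·(Ā·Āᵀ)⁻¹·e. If for each i ∈ S one has d·Σ_{j∈S, j≠i} |Q_iᵀ·Q_j| + |f_i| < c·(Q_iᵀ·Q_i), then for every i ∈ S, |z_i − x̃_i| < |x̃_i|; in particular z_i ≠ 0 and z_i has the same sign as x̃_i. -/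
open Matrix Finset

/-- Theorem 1 (sign recovery by the ℓ2 stage): if for each `i ∈ S`
`d·Σ_{j∈S, j≠i} |Q_iᵀ Q_j| + |f_i| < c·(Q_iᵀ Q_i)`, then the minimum-norm
solution `z` of `Ā x = ȳ` satisfies `|z_i − x̃_i| < |x̃_i|` for all `i ∈ S`;
in particular `z_i ≠ 0` and `z_i` has the sign of `x̃_i`. -/
theorem stmt_6 {m n : ℕ} (hmn : m ≤ n)
    (Abar : Matrix (Fin m) (Fin n) ℝ) (B : Matrix (Fin m) (Fin m) ℝ)
    (Q : Matrix (Fin m) (Fin n) ℝ)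
    (hB : IsUnit B.det) (hQ : Q * Qᵀ = 1) (hA : Abar = B * Q)
    (S : Finset (Fin n)) (xt : Fin n → ℝ) (c d : ℝ) (hc : 0 < c)
    (hsupp : ∀ i ∉ S, xt i = 0)
    (hbound : ∀ i ∈ S, c ≤ |xt i| ∧ |xt i| ≤ d)
    (e : Fin m → ℝ)
    (ybar : Fin m → ℝ) (hy : ybar = Abar *ᵥ xt + e)
    (z : Fin n → ℝ) (hz : z = Abarᵀ *ᵥ ((Abar * Abarᵀ)⁻¹ *ᵥ ybar))
    (f : Fin n → ℝ) (hf : f = Abarᵀ *ᵥ ((Abar * Abarᵀ)⁻¹ *ᵥ e))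
    (hcond : ∀ i ∈ S,
      d * (∑ j ∈ S.erase i, |∑ r, Q r i * Q r j|) + |f i|
        < c * (∑ r, Q r i * Q r i)) :
    ∀ i ∈ S, |z i - xt i| < |xt i| ∧ z i ≠ 0 ∧ 0 < z i * xt i := by
  have hBt : IsUnit Bᵀ.det := by rwa [Matrix.det_transpose]
  have hAA : Abar * Abarᵀ = B * Bᵀ := by
    rw [hA, Matrix.transpose_mul, Matrix.mul_assoc, ← Matrix.mul_assoc Q, hQ, Matrix.one_mul]
  have hP : Abarᵀ * ((Abar * Abarᵀ)⁻¹ * Abar) = Qᵀ * Q := by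
    rw [hAA, hA, Matrix.transpose_mul, Matrix.mul_inv_rev, Matrix.mul_assoc Bᵀ⁻¹,
      ← Matrix.mul_assoc B⁻¹, Matrix.nonsing_inv_mul _ hB, Matrix.one_mul, Matrix.mul_assoc,
      ← Matrix.mul_assoc Bᵀ, Matrix.mul_nonsing_inv _ hBt, Matrix.one_mul]
  have hzf : z = (Qᵀ * Q) *ᵥ xt + f := by
    rw [hz, hf, hy, Matrix.mulVec_add, Matrix.mulVec_add, ← hP]
    simp only [Matrix.mulVec_mulVec]
  have hPP : (Qᵀ * Q) * (Qᵀ * Q) = Qᵀ * Q := by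
    rw [Matrix.mul_assoc, ← Matrix.mul_assoc Q, hQ, Matrix.one_mul]
  have hPe : ∀ i j, (Qᵀ * Q) i j = ∑ r, Q r i * Q r j := by
    intro i j
    simp [Matrix.mul_apply]
  simp only [← hPe] at hcond
  have hsym : ∀ i j, (Qᵀ * Q) i j = (Qᵀ * Q) j i := by
    intro i j
    simp only [hPe, mul_comm]
  generalize Qᵀ * Q = P at *
  intro i hi
  have hq1 : P i i ≤ 1 := by
    have h1 : P i i = ∑ j, P i j * P j i := by
      rw [← Matrix.mul_apply, hPP]
    have h2 : P i i * P i i ≤ ∑ j, P i j * P j i :=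
      Finset.single_le_sum (f := fun j => P i j * P j i)
        (fun j _ => by rw [hsym j i]; exact mul_self_nonneg _) (Finset.mem_univ i)
    nlinarith
  obtain ⟨hci, hdi⟩ := hbound i hi
  have hzi : z i = P i i * xt i + ∑ j ∈ S.erase i, P i j * xt j + f i := by
    rw [hzf, Pi.add_apply, Finset.add_sum_erase S (fun j => P i j * xt j) hi]
    congr 1
    simp only [Matrix.mulVec, dotProduct]
    symm
    apply Finset.sum_subset (Finset.subset_univ S)
    intro j _ hj
    rw [hsupp j hj, mul_zero]
  have hsum : |∑ j ∈ S.erase i, P i j * xt j| ≤ d * ∑ j ∈ S.erase i, |P i j| := by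
    refine (Finset.abs_sum_le_sum_abs _ _).trans ?_
    rw [Finset.mul_sum]
    refine Finset.sum_le_sum fun j hj => ?_
    rw [abs_mul, mul_comm]
    exact mul_le_mul_of_nonneg_right (hbound j (Finset.mem_of_mem_erase hj)).2 (abs_nonneg _)
  have hc1 := hcond i hi
  have hs0 := (abs_nonneg _).trans hsum
  have hq0 : 0 < P i i := by
    have := abs_nonneg (f i)
    by_contra h
    nlinarith
  have key : |z i - xt i| < |xt i| := by
    have e1 : z i - xt i = -((1 - P i i) * xt i) + (∑ j ∈ S.erase i, P i j * xt j) + f i := by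
      rw [hzi]; ring
    have e2 : |z i - xt i| ≤ (1 - P i i) * |xt i| + |∑ j ∈ S.erase i, P i j * xt j| + |f i| := by
      rw [e1]
      refine (abs_add_three _ _ _).trans ?_
      rw [abs_neg, abs_mul, abs_of_nonneg (by linarith : 0 ≤ 1 - P i i)]
    nlinarith
  have hpos : 0 < z i * xt i := by
    have := sq_lt_sq.mpr key
    nlinarith [sq_nonneg (z i)]
  refine ⟨key, ?_, hpos⟩
  intro h
  rw [h, zero_mul] at hpos
  exact lt_irrefl _ hpos
end

section
/- (Coherence version of Theorem 1.) Let m ≤ n and let Ā ∈ ℝ^{m×n} with Ā = B·Q, where B ∈ ℝ^{m×m} is invertible and Q ∈ ℝ^{m×n} satisfies Q·Qᵀ = I_m. Let x̃ ∈ ℝ^n be supported on S ⊆ {1,…,n} with |S| = k ≥ 1 and 0 < c ≤ |x̃_i| ≤ d for all i ∈ S. Let e ∈ ℝ^m, ȳ := Ā·x̃ + e, z := Āᵀ·(Ā·Āᵀ)⁻¹·ȳ, f := Āᵀ·(Ā·Āᵀ)⁻¹·e, and define the coherence of the columns of Q on S as μ(Q_S) := max over distinct i, j ∈ S of |Q_iᵀ·Q_j|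 / (‖Q_i‖₂·‖Q_j‖₂), assuming Q_i ≠ 0 for all i ∈ S. If for each i ∈ S one has d·(k−1)·μ(Q_S)·‖Q_i‖₂·(max_{j∈S} ‖Q_j‖₂) + |f_i| < c·‖Q_i‖₂², then for every i ∈ S, z_i ≠ 0 and z_i has the same sign as x̃_i. -/
open Matrix Finset

/-- Coherence version of Theorem 1: with `μ(Q_S)` the maximal normalized correlation
among distinct columns of `Q` indexed by `S` (set to `0` when there is no pair of
distinct indices, i.e. `k = 1`), if for each `i ∈ S`
`d·(k−1)·μ(Q_S)·‖Q_i‖₂·(max_{j∈S} ‖Q_j‖₂) + |f_i| < c·‖Q_i‖₂²`,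
then the minimum-norm solution `z` has the right signs on `S`. -/
theorem stmt_7 {m n : ℕ} (hmn : m ≤ n)
    (Abar : Matrix (Fin m) (Fin n) ℝ) (B : Matrix (Fin m) (Fin m) ℝ)
    (Q : Matrix (Fin m) (Fin n) ℝ)
    (hB : IsUnit B.det) (hQ : Q * Qᵀ = 1) (hA : Abar = B * Q)
    (S : Finset (Fin n)) (k : ℕ) (hk : 1 ≤ k) (hcard : S.card = k)
    (xt : Fin n → ℝ) (c d : ℝ) (hc : 0 < c)
    (hsupp : ∀ i ∉ S, xt i = 0)
    (hbound : ∀ i ∈ S, c ≤ |xt i| ∧ |xt i| ≤ d)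
    (e : Fin m → ℝ)
    (ybar : Fin m → ℝ) (hy : ybar = Abar *ᵥ xt + e)
    (z : Fin n → ℝ) (hz : z = Abarᵀ *ᵥ ((Abar * Abarᵀ)⁻¹ *ᵥ ybar))
    (f : Fin n → ℝ) (hf : f = Abarᵀ *ᵥ ((Abar * Abarᵀ)⁻¹ *ᵥ e))
    (nQ : Fin n → ℝ) (hnQ : ∀ i, nQ i = Real.sqrt (∑ r, (Q r i) ^ 2))
    (hQnz : ∀ i ∈ S, (0 : ℝ) < nQ i)
    (muQ : ℝ)
    (hmu : muQ = if h : S.offDiag.Nonempty then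
        S.offDiag.sup' h (fun p => |∑ r, Q r p.1 * Q r p.2| / (nQ p.1 * nQ p.2))
      else 0)
    (hcond : ∀ i ∈ S,
      d * ((k : ℝ) - 1) * muQ * nQ i
          * (S.sup' (Finset.card_pos.mp (by rw [hcard]; exact hk)) nQ)
        + |f i| < c * (nQ i) ^ 2) :
    ∀ i ∈ S, z i ≠ 0 ∧ 0 < z i * xt i := by
  have hBt : IsUnit (Bᵀ).det := by rwa [Matrix.det_transpose]
  have hAA : Abar * Abarᵀ = B * Bᵀ := by
    rw [hA, Matrix.transpose_mul, Matrix.mul_assoc, ← Matrix.mul_assoc Q, hQ, Matrix.one_mul]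
  have hP : Abarᵀ * ((Abar * Abarᵀ)⁻¹ * Abar) = Qᵀ * Q := by
    rw [hAA, Matrix.mul_inv_rev, hA, Matrix.transpose_mul, Matrix.mul_assoc (Bᵀ)⁻¹,
      ← Matrix.mul_assoc B⁻¹, Matrix.nonsing_inv_mul _ hB, Matrix.one_mul, Matrix.mul_assoc,
      ← Matrix.mul_assoc Bᵀ, Matrix.mul_nonsing_inv _ hBt, Matrix.one_mul]
  have hz2 : z = (Qᵀ * Q) *ᵥ xt + f := by
    rw [hz, hy, hf, Matrix.mulVec_add, Matrix.mulVec_add, ← hP]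
    simp only [Matrix.mulVec_mulVec]
  intro i hi
  have hzi : z i = (∑ j ∈ S, (∑ r, Q r i * Q r j) * xt j) + f i := by
    rw [hz2, Pi.add_apply]
    congr 1
    have h1 : ((Qᵀ * Q) *ᵥ xt) i = ∑ j, (∑ r, Q r i * Q r j) * xt j := by
      simp [Matrix.mulVec, dotProduct, Matrix.mul_apply]
    rw [h1]
    symm
    apply Finset.sum_subset (Finset.subset_univ S)
    intro j _ hj
    rw [hsupp j hj, mul_zero]
  have hdiag : (∑ r, Q r i * Q r i) = nQ i ^ 2 := by
    rw [hnQ, Real.sq_sqrt (Finset.sum_nonneg fun r _ => sq_nonneg _)]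
    exact Finset.sum_congr rfl fun r _ => (sq _).symm
  rw [← Finset.add_sum_erase S _ hi, hdiag] at hzi
  have hc1 := hcond i hi
  set M := S.sup' (Finset.card_pos.mp (by rw [hcard]; exact hk)) nQ with hM
  have hR : |∑ j ∈ S.erase i, (∑ r, Q r i * Q r j) * xt j|
      ≤ d * ((k : ℝ) - 1) * muQ * nQ i * M := by
    have hterm : ∀ j ∈ S.erase i, |(∑ r, Q r i * Q r j) * xt j| ≤ muQ * nQ i * M * d := by
      intro j hj
      obtain ⟨hji, hjS⟩ := Finset.mem_erase.mp hj
      have hmem : (i, j) ∈ S.offDiag := Finset.mem_offDiag.mpr ⟨hi, hjS, hji.symm⟩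
      have hne : S.offDiag.Nonempty := ⟨_, hmem⟩
      rw [dif_pos hne] at hmu
      have h1 : |∑ r, Q r i * Q r j| / (nQ i * nQ j) ≤ muQ := by
        rw [hmu]
        exact Finset.le_sup' (fun p : Fin n × Fin n =>
          |∑ r, Q r p.1 * Q r p.2| / (nQ p.1 * nQ p.2)) hmem
      have hpi := hQnz i hi
      have hpj := hQnz j hjS
      have hmu0 : 0 ≤ muQ := le_trans (by positivity) h1
      rw [div_le_iff₀ (by positivity)] at h1
      have hjM : nQ j ≤ M := Finset.le_sup' nQ hjS
      have h2 : |∑ r, Q r i * Q r j| ≤ muQ * nQ i * M := by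
        refine h1.trans ?_
        rw [← mul_assoc]
        exact mul_le_mul_of_nonneg_left hjM (by positivity)
      rw [abs_mul]
      exact mul_le_mul h2 (hbound j hjS).2 (abs_nonneg _) ((abs_nonneg _).trans h2)
    refine (Finset.abs_sum_le_sum_abs _ _).trans ((Finset.sum_le_card_nsmul _ _ _ hterm).trans ?_)
    rw [Finset.card_erase_of_mem hi, hcard, nsmul_eq_mul, Nat.cast_sub hk, Nat.cast_one]
    apply le_of_eq
    ring
  set R := ∑ j ∈ S.erase i, (∑ r, Q r i * Q r j) * xt j with hRdef
  have hx := (hbound i hi).1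
  have hxp : 0 < |xt i| := hc.trans_le hx
  have hlt : |R + f i| < |xt i| * nQ i ^ 2 := by
    have h3 := abs_add_le R (f i)
    have h4 := mul_le_mul_of_nonneg_right hx (sq_nonneg (nQ i))
    linarith
  have hpos : 0 < z i * xt i := by
    have h5 : z i * xt i = |xt i| * (|xt i| * nQ i ^ 2) + (R + f i) * xt i := by
      have := abs_mul_abs_self (xt i)
      rw [hzi]
      linear_combination (-(nQ i ^ 2)) * this
    have h6 := neg_abs_le ((R + f i) * xt i)
    rw [abs_mul] at h6
    have h7 := mul_lt_mul_of_pos_left hlt hxp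
    rw [h5]
    linarith
  refine ⟨?_, hpos⟩
  intro h0
  rw [h0, zero_mul] at hpos
  exact lt_irrefl _ hpos
end

section
/- (Weak-duality step of the ℓ1-stage analysis.) Let Ā ∈ ℝ^{m×n} have ℓ2-normalized columns, let S ⊆ {1,…,n} with |S| = k, and let φ, τ, ψ, ν be positive reals with φ·k·ψ ≤ τ·ν. Assume the dual-feasibility conditions: for each i ∈ S, ψ·Σ_{l∈S, l≠i} |Ā_iᵀ·Ā_l| + 1 + ν ≤ ψ, and for each i ∉ S, ψ·Σ_{l∈S} |Ā_iᵀ·Ā_l| + ν ≤ 1. Let v ∈ ℝ^n have nonnegative entries and satisfy, for every i, v_i − Σ_{j≠i} |Ā_iᵀ·Ā_j|·v_j ≤ φ, and suppose v_{j₀} > τ for some index j₀. Then Σ_{i∉S} v_i − Σ_{i∈S} v_i > 0. -/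
open Matrix Finset

/-- Weak-duality step of the ℓ1-stage analysis: under the dual-feasibility
conditions for `(ψ, ν)` and the primal constraints `Γ v ≤ φ𝟙` with `v ≥ 0` and
`v_{j₀} > τ`, one has `Σ_{i∉S} v_i − Σ_{i∈S} v_i > 0`. -/
theorem stmt_11 {m n : ℕ} (Abar : Matrix (Fin m) (Fin n) ℝ)
    (hnorm : ∀ i, ∑ r, (Abar r i) ^ 2 = 1)
    (S : Finset (Fin n)) (k : ℕ) (hcard : S.card = k)
    (phi tau psi nu : ℝ)
    (hphi : 0 < phi) (htau : 0 < tau) (hpsi : 0 < psi) (hnu : 0 < nu)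
    (hdualobj : phi * k * psi ≤ tau * nu)
    (hdual1 : ∀ i ∈ S,
      psi * (∑ l ∈ S.erase i, |∑ r, Abar r i * Abar r l|) + 1 + nu ≤ psi)
    (hdual2 : ∀ i ∉ S,
      psi * (∑ l ∈ S, |∑ r, Abar r i * Abar r l|) + nu ≤ 1)
    (v : Fin n → ℝ) (hv0 : ∀ i, 0 ≤ v i)
    (hv : ∀ i, v i - ∑ j ∈ Finset.univ.erase i, |∑ r, Abar r i * Abar r j| * v j ≤ phi)
    (j₀ : Fin n) (hj₀ : tau < v j₀) :
    0 < (∑ i ∈ Sᶜ, v i) - ∑ i ∈ S, v i := by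
  classical
  obtain ⟨g, hg⟩ : ∃ g : Fin n → Fin n → ℝ, ∀ i j, g i j = |∑ r, Abar r i * Abar r j| :=
    ⟨_, fun _ _ => rfl⟩
  have hsymm : ∀ i j, g i j = g j i := by
    intro i j
    rw [hg, hg]
    simp only [mul_comm]
  simp only [← hg] at hdual1 hdual2 hv
  obtain ⟨c, hc⟩ : ∃ c : Fin n → ℝ, ∀ j, c j = ∑ l ∈ S, if l = j then 0 else g l j :=
    ⟨_, fun _ => rfl⟩
  have h1 : ∀ i ∈ S, c i = ∑ l ∈ S.erase i, g i l := by
    intro i hi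
    rw [hc, ← Finset.add_sum_erase S _ hi, if_pos rfl, zero_add]
    refine Finset.sum_congr rfl fun l hl => ?_
    rw [if_neg (Finset.ne_of_mem_erase hl), hsymm]
  have h2 : ∀ i, i ∉ S → c i = ∑ l ∈ S, g i l := by
    intro i hi
    rw [hc]
    refine Finset.sum_congr rfl fun l hl => ?_
    have hne : l ≠ i := fun h => hi (h ▸ hl)
    rw [if_neg hne, hsymm]
  have h3 : ∀ i, ∑ j ∈ Finset.univ.erase i, g i j * v j
      = ∑ j, (if i = j then 0 else g i j) * v j := by
    intro i
    rw [← Finset.add_sum_erase Finset.univ (fun j => (if i = j then 0 else g i j) * v j)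
      (Finset.mem_univ i)]
    simp only [if_true, zero_mul, zero_add]
    refine Finset.sum_congr rfl fun l hl => ?_
    rw [if_neg (Finset.ne_of_mem_erase hl).symm]
  have h4 : ∑ i ∈ S, v i - ∑ j, c j * v j ≤ k * phi := by
    have h := Finset.sum_le_sum (s := S) fun i _ => hv i
    simp only [h3] at h
    rw [Finset.sum_sub_distrib, Finset.sum_comm, Finset.sum_const, hcard, nsmul_eq_mul] at h
    simpa only [hc, Finset.sum_mul] using h
  have h5 : ∑ i ∈ S, (psi * (c i * v i) + nu * v i - psi * v i) ≤ ∑ i ∈ S, - v i := by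
    refine Finset.sum_le_sum fun i hi => ?_
    have h := hdual1 i hi
    rw [← h1 i hi] at h
    nlinarith [mul_le_mul_of_nonneg_right h (hv0 i)]
  have h6 : ∑ i ∈ Sᶜ, (psi * (c i * v i) + nu * v i) ≤ ∑ i ∈ Sᶜ, v i := by
    refine Finset.sum_le_sum fun i hi => ?_
    have hi' := Finset.mem_compl.1 hi
    have h := hdual2 i hi'
    rw [← h2 i hi'] at h
    nlinarith [mul_le_mul_of_nonneg_right h (hv0 i)]
  have h7 : v j₀ ≤ ∑ j, v j :=
    Finset.single_le_sum (fun i _ => hv0 i) (Finset.mem_univ j₀)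
  simp only [Finset.sum_sub_distrib, Finset.sum_add_distrib, ← Finset.mul_sum,
    Finset.sum_neg_distrib] at h5 h6
  rw [← Finset.sum_add_sum_compl S] at h4 h7
  have h8 := mul_le_mul_of_nonneg_left h4 hpsi.le
  have h9 := mul_lt_mul_of_pos_left (hj₀.trans_le h7) hnu
  nlinarith
end

section
/- (Dual feasibility from the γ-condition.) Let Ā ∈ ℝ^{m×n} and let S ⊆ {1,…,n} be nonempty with nonempty complement. Define M₁ := max_{i∈S} Σ_{l∈S, l≠i} |Ā_iᵀ·Ā_l|, M₂ := max_{j∉S} Σ_{l∈S} |Ā_jᵀ·Ā_l|, and γ(Ā) := M₁ + M₂. Suppose ξ > 0 and γ(Ā) ≤ 1 − 2ξ. Then ψ := 1/(M₂ + ξ) and ν := ξ·ψ are positive and satisfy: for each i ∈ S, ψ·Σ_{l∈S, l≠i} |Ā_iᵀ·Ā_l| + 1 + ν ≤ ψ, and for each i ∉ S, ψ·Σ_{l∈S} |Ā_iᵀ·Ā_l| + ν ≤ 1. -/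
open Matrix Finset

/-- Dual feasibility from the γ-condition: with
`M₁ = max_{i∈S} Σ_{l∈S,l≠i} |Ā_iᵀĀ_l|`, `M₂ = max_{j∉S} Σ_{l∈S} |Ā_jᵀĀ_l|`,
if `ξ > 0` and `M₁ + M₂ ≤ 1 − 2ξ`, then `ψ = 1/(M₂+ξ)` and `ν = ξψ` are positive
and dual feasible. -/
theorem stmt_13 {m n : ℕ} (Abar : Matrix (Fin m) (Fin n) ℝ)
    (S : Finset (Fin n)) (hS : S.Nonempty) (hSc : Sᶜ.Nonempty)
    (M₁ M₂ : ℝ)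
    (hM₁ : M₁ = S.sup' hS (fun i => ∑ l ∈ S.erase i, |∑ r, Abar r i * Abar r l|))
    (hM₂ : M₂ = Sᶜ.sup' hSc (fun j => ∑ l ∈ S, |∑ r, Abar r j * Abar r l|))
    (xi : ℝ) (hxi : 0 < xi) (hgamma : M₁ + M₂ ≤ 1 - 2 * xi)
    (psi nu : ℝ) (hpsi : psi = 1 / (M₂ + xi)) (hnu : nu = xi * psi) :
    0 < psi ∧ 0 < nu ∧
    (∀ i ∈ S,
      psi * (∑ l ∈ S.erase i, |∑ r, Abar r i * Abar r l|) + 1 + nu ≤ psi) ∧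
    (∀ i ∉ S,
      psi * (∑ l ∈ S, |∑ r, Abar r i * Abar r l|) + nu ≤ 1) := by
  have h1 : ∀ i ∈ S, (∑ l ∈ S.erase i, |∑ r, Abar r i * Abar r l|) ≤ M₁ := by
    intro i hi
    rw [hM₁]
    exact Finset.le_sup' (fun i => ∑ l ∈ S.erase i, |∑ r, Abar r i * Abar r l|) hi
  have h2 : ∀ i ∉ S, (∑ l ∈ S, |∑ r, Abar r i * Abar r l|) ≤ M₂ := by
    intro i hi
    rw [hM₂]
    exact Finset.le_sup' (fun j => ∑ l ∈ S, |∑ r, Abar r j * Abar r l|)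
      (Finset.mem_compl.2 hi)
  have h0 : 0 ≤ M₂ := by
    obtain ⟨j, hj⟩ := hSc
    exact le_trans (Finset.sum_nonneg fun _ _ => abs_nonneg _) (h2 j (Finset.mem_compl.1 hj))
  have hpos : 0 < M₂ + xi := by linarith
  have hp : 0 < psi := by rw [hpsi]; positivity
  have he : psi * (M₂ + xi) = 1 := by rw [hpsi]; field_simp
  refine ⟨hp, by rw [hnu]; positivity, fun i hi => ?_, fun i hi => ?_⟩
  · have h := h1 i hi
    have := mul_le_mul_of_nonneg_left (show (∑ l ∈ S.erase i, |∑ r, Abar r i * Abar r l|)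
      + (M₂ + xi) + xi ≤ 1 by linarith) hp.le
    rw [hnu]
    linarith
  · have := mul_le_mul_of_nonneg_left (h2 i hi) hp.le
    rw [hnu]
    linarith
end

section
/- (Theorem 2, estimation error of the ℓ1 stage.) Let Ā ∈ ℝ^{m×n} have ℓ2-normalized columns, let ȳ ∈ ℝ^m, Δ_y, Δ_A ≥ 0, and d > 0. Let x̃ ∈ ℝ^n be supported on a set S with |S| = k ≥ 1 and nonempty complement, with ‖x̃‖₁ ≤ k·d. Let x̂ ∈ ℝ^n satisfy: (i) feasibility, ‖Ā·x̂ − ȳ‖_∞ ≤ Δ_y + Δ_A·‖x̂‖₁ and ‖Ā·x̃ − ȳ‖_∞ ≤ Δ_y + Δ_A·‖x̃‖₁; (ii) ℓ1-optimality, ‖x̂‖₁ ≤ ‖x̃‖₁; (iii) ‖x̂‖₁ ≤ k̂·d for some k̂ ≥ 0. Define φ := √m·(2Δ_y + Δ_A·(k + k̂)·d) and γ(Ā) := max_{i∈S} Σ_{l∈S, l≠i} |Ā_iᵀ·Ā_l| + max_{j∉S} Σ_{l∈S} |Ā_jᵀ·Ā_l|. If τ > 0 and there exists ξ > 0 such that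 φ·k ≤ τ·ξ and γ(Ā) ≤ 1 − 2ξ, then ‖x̂ − x̃‖_∞ ≤ τ. -/
open Matrix Finset

/-- Theorem 2, estimation-error part: if `x̂` solves the LP relaxation with correct
signs (feasibility, ℓ1-optimality, and ℓ1-norm bound `k̂ d`), and there is `ξ > 0`
with `φ k ≤ τ ξ` and `γ(Ā) ≤ 1 − 2ξ`, where
`φ = √m (2Δ_y + Δ_A (k + k̂) d)`, then `‖x̂ − x̃‖_∞ ≤ τ`. -/
theorem stmt_14 {m n : ℕ} (Abar : Matrix (Fin m) (Fin n) ℝ)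
    (hnorm : ∀ i, ∑ r, (Abar r i) ^ 2 = 1)
    (ybar : Fin m → ℝ) (Deltay DeltaA : ℝ) (hDy : 0 ≤ Deltay) (hDA : 0 ≤ DeltaA)
    (d : ℝ) (hd : 0 < d)
    (S : Finset (Fin n)) (k : ℕ) (hcard : S.card = k) (hk : 1 ≤ k)
    (hSc : Sᶜ.Nonempty)
    (xt : Fin n → ℝ) (hsupp : ∀ i ∉ S, xt i = 0)
    (hxt1 : ∑ j, |xt j| ≤ k * d)
    (xhat : Fin n → ℝ)
    (hfeas1 : ∀ r, |(Abar *ᵥ xhat - ybar) r| ≤ Deltay + DeltaA * ∑ j, |xhat j|)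
    (hfeas2 : ∀ r, |(Abar *ᵥ xt - ybar) r| ≤ Deltay + DeltaA * ∑ j, |xt j|)
    (hopt : ∑ j, |xhat j| ≤ ∑ j, |xt j|)
    (khat : ℝ) (hkhat : 0 ≤ khat) (hxhat1 : ∑ j, |xhat j| ≤ khat * d)
    (phi : ℝ) (hphi : phi = Real.sqrt m * (2 * Deltay + DeltaA * ((k : ℝ) + khat) * d))
    (gamma : ℝ)
    (hgamma : gamma =
      S.sup' (Finset.card_pos.mp (by rw [hcard]; exact hk))
          (fun i => ∑ l ∈ S.erase i, |∑ r, Abar r i * Abar r l|)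
        + Sᶜ.sup' hSc (fun j => ∑ l ∈ S, |∑ r, Abar r j * Abar r l|))
    (tau : ℝ) (htau : 0 < tau)
    (xi : ℝ) (hxi : 0 < xi)
    (hcond1 : phi * k ≤ tau * xi) (hcond2 : gamma ≤ 1 - 2 * xi) :
    ∀ i, |xhat i - xt i| ≤ tau := by
  classical
  set h : Fin n → ℝ := fun j => xhat j - xt j with hh
  set G : Fin n → Fin n → ℝ := fun i l => ∑ r, Abar r i * Abar r l with hG
  have hGsymm : ∀ i l, G i l = G l i := fun i l =>
    Finset.sum_congr rfl (fun r _ => mul_comm _ _)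
  have hGd : ∀ i, G i i = 1 := by
    intro i
    rw [← hnorm i]
    exact Finset.sum_congr rfl (fun r _ => (sq _).symm)
  set e : ℝ := 2 * Deltay + DeltaA * ((k : ℝ) + khat) * d with he
  have he0 : 0 ≤ e := by positivity
  set w : Fin m → ℝ := fun r => ∑ l, Abar r l * h l with hw
  have hwb : ∀ r, |w r| ≤ e := by
    intro r
    have e1 : w r = (Abar *ᵥ xhat - ybar) r - (Abar *ᵥ xt - ybar) r := by
      simp only [hw, hh, Pi.sub_apply, Matrix.mulVec, dotProduct, mul_sub, Finset.sum_sub_distrib]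
      ring
    rw [e1]
    have h3 := abs_sub ((Abar *ᵥ xhat - ybar) r) ((Abar *ᵥ xt - ybar) r)
    have h1 := hfeas1 r
    have h2 := hfeas2 r
    have h4 := mul_le_mul_of_nonneg_left hxt1 hDA
    have h5 := mul_le_mul_of_nonneg_left hxhat1 hDA
    rw [he]
    linarith
  have hGw : ∀ i, ∑ l, G i l * h l = ∑ r, Abar r i * w r := by
    intro i
    simp only [hG, hw, Finset.sum_mul, Finset.mul_sum]
    rw [Finset.sum_comm]
    exact Finset.sum_congr rfl (fun r _ => Finset.sum_congr rfl (fun l _ => mul_assoc _ _ _))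
  have hGb : ∀ i, |∑ l, G i l * h l| ≤ phi := by
    intro i
    rw [hGw, hphi]
    apply abs_le_of_sq_le_sq _ (by positivity)
    calc (∑ r, Abar r i * w r) ^ 2 ≤ (∑ r, Abar r i ^ 2) * ∑ r, w r ^ 2 :=
          Finset.sum_mul_sq_le_sq_mul_sq _ _ _
      _ = ∑ r, w r ^ 2 := by rw [hnorm, one_mul]
      _ ≤ ∑ r : Fin m, e ^ 2 := by
          refine Finset.sum_le_sum (fun r _ => ?_)
          exact sq_le_sq' (abs_le.mp (hwb r)).1 (abs_le.mp (hwb r)).2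
      _ = (Real.sqrt m * e) ^ 2 := by
          rw [mul_pow, Real.sq_sqrt (Nat.cast_nonneg m)]
          simp
  have hcone : ∑ j ∈ Sᶜ, |h j| ≤ ∑ j ∈ S, |h j| := by
    have h1 := Finset.sum_add_sum_compl S (fun j => |xhat j|)
    have h2 := Finset.sum_add_sum_compl S (fun j => |xt j|)
    have h3 : ∑ j ∈ Sᶜ, |xt j| = 0 := Finset.sum_eq_zero (fun j hj => by
      rw [hsupp j (Finset.mem_compl.mp hj), abs_zero])
    have h4 : ∑ j ∈ Sᶜ, |h j| = ∑ j ∈ Sᶜ, |xhat j| := Finset.sum_congr rfl (fun j hj => by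
      simp only [hh]
      rw [hsupp j (Finset.mem_compl.mp hj), sub_zero])
    have h5 : ∑ j ∈ S, |xt j| ≤ ∑ j ∈ S, |xhat j| + ∑ j ∈ S, |h j| := by
      rw [← Finset.sum_add_distrib]
      refine Finset.sum_le_sum (fun j _ => ?_)
      have h6 := abs_sub (xhat j) (h j)
      have h7 : xhat j - h j = xt j := by simp [hh]
      rwa [h7] at h6
    linarith
  have hSne : S.Nonempty := Finset.card_pos.mp (by rw [hcard]; exact hk)
  obtain ⟨a, ha⟩ : ∃ a, a = S.sup' hSne (fun i => ∑ l ∈ S.erase i, |G i l|) := ⟨_, rfl⟩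
  obtain ⟨b, hb⟩ : ∃ b, b = Sᶜ.sup' hSc (fun j => ∑ l ∈ S, |G j l|) := ⟨_, rfl⟩
  have hab : a + b ≤ 1 - 2 * xi := by
    rw [ha, hb]; rw [hgamma] at hcond2; exact hcond2
  have hai : ∀ i ∈ S, ∑ l ∈ S.erase i, |G i l| ≤ a := fun i hi => by
    rw [ha]; exact Finset.le_sup' (fun i => ∑ l ∈ S.erase i, |G i l|) hi
  have hbi : ∀ j ∈ Sᶜ, ∑ l ∈ S, |G j l| ≤ b := fun j hj => by
    rw [hb]; exact Finset.le_sup' (fun j => ∑ l ∈ S, |G j l|) hj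
  have hb0 : 0 ≤ b := by
    obtain ⟨j, hj⟩ := hSc
    exact (Finset.sum_nonneg (fun _ _ => abs_nonneg _)).trans (hbi j hj)
  have hper : ∀ i ∈ S, |h i| ≤ phi + ∑ l ∈ S.erase i, |G i l| * |h l|
      + ∑ j ∈ Sᶜ, |G i j| * |h j| := by
    intro i hi
    have h1 := Finset.sum_add_sum_compl S (fun l => G i l * h l)
    have h2 := Finset.add_sum_erase S (fun l => G i l * h l) hi
    simp only [hGd, one_mul] at h2
    have h3 : |∑ l ∈ S.erase i, G i l * h l| ≤ ∑ l ∈ S.erase i, |G i l| * |h l| := by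
      simpa only [abs_mul] using Finset.abs_sum_le_sum_abs (fun l => G i l * h l) (S.erase i)
    have h4 : |∑ l ∈ Sᶜ, G i l * h l| ≤ ∑ l ∈ Sᶜ, |G i l| * |h l| := by
      simpa only [abs_mul] using Finset.abs_sum_le_sum_abs (fun l => G i l * h l) Sᶜ
    have h5 := abs_le.mp (hGb i)
    have h6 := abs_le.mp h3
    have h7 := abs_le.mp h4
    rw [abs_le]
    constructor <;> linarith [h5.1, h5.2, h6.1, h6.2, h7.1, h7.2]
  have hT1 : ∑ i ∈ S, ∑ l ∈ S.erase i, |G i l| * |h l| ≤ a * ∑ l ∈ S, |h l| := by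
    rw [Finset.sum_comm' (t' := S) (s' := fun l => S.erase l)
      (by intro x y; simp only [Finset.mem_erase]; tauto), Finset.mul_sum]
    refine Finset.sum_le_sum (fun l hl => ?_)
    rw [← Finset.sum_mul]
    refine mul_le_mul_of_nonneg_right ?_ (abs_nonneg _)
    simp only [hGsymm _ l]
    exact hai l hl
  have hT2 : ∑ i ∈ S, ∑ j ∈ Sᶜ, |G i j| * |h j| ≤ b * ∑ j ∈ Sᶜ, |h j| := by
    rw [Finset.sum_comm, Finset.mul_sum]
    refine Finset.sum_le_sum (fun l hl => ?_)
    rw [← Finset.sum_mul]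
    refine mul_le_mul_of_nonneg_right ?_ (abs_nonneg _)
    simp only [hGsymm _ l]
    exact hbi l hl
  have hsum := Finset.sum_le_sum hper
  rw [Finset.sum_add_distrib, Finset.sum_add_distrib, Finset.sum_const, hcard, nsmul_eq_mul] at hsum
  have hN0 : 0 ≤ ∑ l ∈ S, |h l| := Finset.sum_nonneg (fun _ _ => abs_nonneg _)
  have hT3 := mul_le_mul_of_nonneg_left hcone hb0
  have hT4 := mul_le_mul_of_nonneg_right hab hN0
  have hfin : xi * (2 * ∑ l ∈ S, |h l|) ≤ xi * tau := by nlinarith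
  have hfin2 := le_of_mul_le_mul_left hfin hxi
  intro i
  have h1 := Finset.sum_add_sum_compl S (fun j => |h j|)
  have h2 : |h i| ≤ ∑ j, |h j| :=
    Finset.single_le_sum (f := fun j => |h j|) (fun _ _ => abs_nonneg _) (Finset.mem_univ i)
  change |h i| ≤ tau
  linarith
end

section
/- (Theorem 2, exact support recovery.) Let Ā ∈ ℝ^{m×n} have ℓ2-normalized columns, let ȳ ∈ ℝ^m, Δ_y, Δ_A ≥ 0, and 0 < c ≤ d. Let x̃ ∈ ℝ^n be supported on a set S with |S| = k ≥ 1 and nonempty complement, with c ≤ |x̃_i| ≤ d for every i ∈ S. Let x̂ ∈ ℝ^n satisfy: (i) ‖Ā·x̂ − ȳ‖_∞ ≤ Δ_y + Δ_A·‖x̂‖₁ and ‖Ā·x̃ − ȳ‖_∞ ≤ Δ_y + Δ_A·‖x̃‖₁; (ii) ‖x̂‖₁ ≤ ‖x̃‖₁; (iii) ‖x̂‖₁ ≤ k̂·d for some k̂ ≥ 0. Define φ := √m·(2Δ_y + Δ_A·(k + k̂)·d) and γ(Ā) := max_{i∈S} Σ_{l∈S, l≠i} |Ā_iᵀ·Ā_l|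 + max_{j∉S} Σ_{l∈S} |Ā_jᵀ·Ā_l|. If τ is a threshold with 0 < 2τ < c and there exists ξ > 0 such that φ·k ≤ τ·ξ and γ(Ā) ≤ 1 − 2ξ, then {i : |x̂_i| > τ} = S; i.e., thresholding x̂ at level τ selects exactly the true significant parameters. -/
open Matrix Finset

/-- Theorem 2, exact support recovery: under the feasibility/optimality conditions
on the LP solution `x̂` and the conditions `φ k ≤ τ ξ`, `γ(Ā) ≤ 1 − 2ξ` with
`0 < 2τ < c`, thresholding `x̂` at level `τ` selects exactly the support `S`. -/
theorem stmt_17 {m n : ℕ} (Abar : Matrix (Fin m) (Fin n) ℝ)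
    (hnorm : ∀ i, ∑ r, (Abar r i) ^ 2 = 1)
    (ybar : Fin m → ℝ) (Deltay DeltaA : ℝ) (hDy : 0 ≤ Deltay) (hDA : 0 ≤ DeltaA)
    (c d : ℝ) (hc : 0 < c) (hcd : c ≤ d)
    (S : Finset (Fin n)) (k : ℕ) (hcard : S.card = k) (hk : 1 ≤ k)
    (hSc : Sᶜ.Nonempty)
    (xt : Fin n → ℝ) (hsupp : ∀ i ∉ S, xt i = 0)
    (hmag : ∀ i ∈ S, c ≤ |xt i| ∧ |xt i| ≤ d)
    (xhat : Fin n → ℝ)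
    (hfeas1 : ∀ r, |(Abar *ᵥ xhat - ybar) r| ≤ Deltay + DeltaA * ∑ j, |xhat j|)
    (hfeas2 : ∀ r, |(Abar *ᵥ xt - ybar) r| ≤ Deltay + DeltaA * ∑ j, |xt j|)
    (hopt : ∑ j, |xhat j| ≤ ∑ j, |xt j|)
    (khat : ℝ) (hkhat : 0 ≤ khat) (hxhat1 : ∑ j, |xhat j| ≤ khat * d)
    (phi : ℝ) (hphi : phi = Real.sqrt m * (2 * Deltay + DeltaA * ((k : ℝ) + khat) * d))
    (gamma : ℝ)
    (hgamma : gamma =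
      S.sup' (Finset.card_pos.mp (by rw [hcard]; exact hk))
          (fun i => ∑ l ∈ S.erase i, |∑ r, Abar r i * Abar r l|)
        + Sᶜ.sup' hSc (fun j => ∑ l ∈ S, |∑ r, Abar r j * Abar r l|))
    (tau : ℝ) (htau : 0 < tau) (htc : 2 * tau < c)
    (xi : ℝ) (hxi : 0 < xi)
    (hcond1 : phi * k ≤ tau * xi) (hcond2 : gamma ≤ 1 - 2 * xi) :
    ∀ i, tau < |xhat i| ↔ i ∈ S := by
  classical
  obtain ⟨h, hh⟩ : ∃ h : Fin n → ℝ, h = xhat - xt := ⟨_, rfl⟩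
  have hhi : ∀ i, h i = xhat i - xt i := fun i => by rw [hh]; rfl
  obtain ⟨G, hG⟩ : ∃ G : Fin n → Fin n → ℝ, G = fun i l => ∑ r, Abar r i * Abar r l := ⟨_, rfl⟩
  have hGsymm : ∀ i l, G i l = G l i := fun i l => by
    rw [hG]; exact Finset.sum_congr rfl fun r _ => mul_comm _ _
  have hGd : ∀ i, G i i = 1 := fun i => by
    rw [hG, ← hnorm i]; exact Finset.sum_congr rfl fun r _ => (sq _).symm
  have hd : 0 < d := lt_of_lt_of_le hc hcd
  have hxt1 : ∑ j, |xt j| ≤ k * d := by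
    rw [← Finset.sum_subset (Finset.subset_univ S) (fun i _ hi => by rw [hsupp i hi, abs_zero])]
    calc ∑ j ∈ S, |xt j| ≤ ∑ j ∈ S, d := Finset.sum_le_sum fun i hi => (hmag i hi).2
      _ = k * d := by rw [Finset.sum_const, hcard, nsmul_eq_mul]
  obtain ⟨ε, hε⟩ : ∃ ε : ℝ, ε = 2 * Deltay + DeltaA * ((k : ℝ) + khat) * d := ⟨_, rfl⟩
  have hε0 : 0 ≤ ε := by rw [hε]; positivity
  have hAh : ∀ r, |(Abar *ᵥ h) r| ≤ ε := by
    intro r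
    have e : (Abar *ᵥ h) r = (Abar *ᵥ xhat - ybar) r - (Abar *ᵥ xt - ybar) r := by
      rw [hh, Matrix.mulVec_sub]; simp
    rw [e]
    refine (abs_sub _ _).trans ?_
    have h1 := mul_le_mul_of_nonneg_left hxt1 hDA
    have h2 := mul_le_mul_of_nonneg_left hxhat1 hDA
    have := hfeas1 r
    have := hfeas2 r
    rw [hε]; nlinarith
  have hcorr : ∀ i, |∑ l, G i l * h l| ≤ phi := by
    intro i
    have e : ∑ l, G i l * h l = ∑ r, Abar r i * (Abar *ᵥ h) r := by
      simp only [hG, Matrix.mulVec, dotProduct, Finset.sum_mul, Finset.mul_sum]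
      rw [Finset.sum_comm]
      exact Finset.sum_congr rfl fun r _ => Finset.sum_congr rfl fun l _ => mul_assoc _ _ _
    have cs := Finset.sum_mul_sq_le_sq_mul_sq Finset.univ (fun r => Abar r i) (fun r => (Abar *ᵥ h) r)
    rw [hnorm i, one_mul] at cs
    have h2 : ∑ r, ((Abar *ᵥ h) r) ^ 2 ≤ m * ε ^ 2 := by
      calc ∑ r, ((Abar *ᵥ h) r) ^ 2 ≤ ∑ r : Fin m, ε ^ 2 :=
            Finset.sum_le_sum fun r _ => sq_le_sq' (abs_le.mp (hAh r)).1 (abs_le.mp (hAh r)).2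
        _ = m * ε ^ 2 := by simp
    rw [e, hphi, ← hε]
    apply abs_le_of_sq_le_sq _ (by positivity)
    rw [mul_pow, Real.sq_sqrt (Nat.cast_nonneg m)]
    exact cs.trans h2
  obtain ⟨P, hP⟩ : ∃ P, P = ∑ i ∈ S, |h i| := ⟨_, rfl⟩
  obtain ⟨Q, hQ⟩ : ∃ Q, Q = ∑ i ∈ Sᶜ, |h i| := ⟨_, rfl⟩
  have hQP : Q ≤ P := by
    rw [← Finset.sum_add_sum_compl S (fun j => |xhat j|),
      ← Finset.sum_add_sum_compl S (fun j => |xt j|)] at hopt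
    have a : ∑ i ∈ Sᶜ, |xt i| = 0 := Finset.sum_eq_zero fun i hi => by
      rw [hsupp i (Finset.mem_compl.mp hi), abs_zero]
    have b : Q = ∑ i ∈ Sᶜ, |xhat i| := by
      rw [hQ]
      exact Finset.sum_congr rfl fun i hi => by
        rw [hhi, hsupp i (Finset.mem_compl.mp hi), sub_zero]
    have c' : ∑ i ∈ S, |xt i| ≤ ∑ i ∈ S, |xhat i| + P := by
      rw [hP, ← Finset.sum_add_distrib]
      refine Finset.sum_le_sum fun i _ => ?_
      have := abs_sub (xhat i) (xhat i - xt i)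
      rw [hhi]
      simpa using this
    linarith
  have hP0 : 0 ≤ P := hP ▸ Finset.sum_nonneg fun i _ => abs_nonneg _
  obtain ⟨g1, hg1⟩ : ∃ g1, g1 = S.sup' (Finset.card_pos.mp (by rw [hcard]; exact hk))
          (fun i => ∑ l ∈ S.erase i, |∑ r, Abar r i * Abar r l|) := ⟨_, rfl⟩
  obtain ⟨g2, hg2⟩ : ∃ g2, g2 = Sᶜ.sup' hSc (fun j => ∑ l ∈ S, |∑ r, Abar r j * Abar r l|) :=
    ⟨_, rfl⟩
  rw [← hg1, ← hg2] at hgamma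
  have hb1 : ∀ i ∈ S, ∑ l ∈ S.erase i, |G i l| ≤ g1 := fun i hi => by
    rw [hg1, hG]
    exact Finset.le_sup' (fun i => ∑ l ∈ S.erase i, |∑ r, Abar r i * Abar r l|) hi
  have hb2 : ∀ j ∈ Sᶜ, ∑ l ∈ S, |G j l| ≤ g2 := fun i hi => by
    rw [hg2, hG]
    exact Finset.le_sup' (fun j => ∑ l ∈ S, |∑ r, Abar r j * Abar r l|) hi
  have hg20 : 0 ≤ g2 := by
    obtain ⟨j, hj⟩ := hSc
    exact (Finset.sum_nonneg fun i _ => abs_nonneg _).trans (hb2 j hj)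
  have hrow : ∀ i ∈ S, |h i| ≤ phi + ∑ l ∈ S.erase i, |G i l| * |h l|
      + ∑ j ∈ Sᶜ, |G i j| * |h j| := by
    intro i hi
    have e := Finset.sum_add_sum_compl S (fun l => G i l * h l)
    rw [← Finset.add_sum_erase S _ hi] at e
    simp only [hGd, one_mul] at e
    have e' : h i = ∑ l, G i l * h l - ∑ l ∈ S.erase i, G i l * h l - ∑ j ∈ Sᶜ, G i j * h j := by
      linarith
    have t1 := Finset.abs_sum_le_sum_abs (fun l => G i l * h l) (S.erase i)
    have t2 := Finset.abs_sum_le_sum_abs (fun l => G i l * h l) Sᶜ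
    simp only [abs_mul] at t1 t2
    have t3 := hcorr i
    rw [e']
    refine (abs_sub _ _).trans ?_
    have := abs_sub (∑ l, G i l * h l) (∑ l ∈ S.erase i, G i l * h l)
    linarith
  have hsum : P ≤ k * phi + g1 * P + g2 * Q := by
    have s0 := Finset.sum_le_sum hrow
    rw [← hP, Finset.sum_add_distrib, Finset.sum_add_distrib, Finset.sum_const, hcard,
      nsmul_eq_mul] at s0
    have s1 : ∑ i ∈ S, ∑ l ∈ S.erase i, |G i l| * |h l| ≤ g1 * P := by
      rw [Finset.sum_comm' (t' := S) (s' := fun l => S.erase l)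
        (by intro x y; simp only [Finset.mem_erase]; tauto), hP, Finset.mul_sum]
      refine Finset.sum_le_sum fun l hl => ?_
      rw [← Finset.sum_mul]
      refine mul_le_mul_of_nonneg_right ?_ (abs_nonneg _)
      simpa only [hGsymm l] using hb1 l hl
    have s2 : ∑ i ∈ S, ∑ j ∈ Sᶜ, |G i j| * |h j| ≤ g2 * Q := by
      rw [Finset.sum_comm, hQ, Finset.mul_sum]
      refine Finset.sum_le_sum fun l hl => ?_
      rw [← Finset.sum_mul]
      refine mul_le_mul_of_nonneg_right ?_ (abs_nonneg _)
      simpa only [hGsymm l] using hb2 l hl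
    linarith
  have hPt : P ≤ tau / 2 := by
    have u1 := mul_le_mul_of_nonneg_left hQP hg20
    have u2 := mul_le_mul_of_nonneg_right hcond2 hP0
    rw [hgamma] at u2
    have u3 : 2 * P * xi ≤ tau * xi := by linarith
    have := le_of_mul_le_mul_right u3 hxi
    linarith
  intro i
  constructor
  · intro hi
    by_contra hS
    have : |h i| ≤ Q := by
      rw [hQ]
      exact Finset.single_le_sum (f := fun i => |h i|) (fun _ _ => abs_nonneg _)
        (Finset.mem_compl.mpr hS)
    rw [hhi, hsupp i hS, sub_zero] at this
    linarith
  · intro hi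
    have h1 : |h i| ≤ P := by
      rw [hP]
      exact Finset.single_le_sum (f := fun i => |h i|) (fun _ _ => abs_nonneg _) hi
    rw [hhi] at h1
    have h2 := abs_sub (xhat i) (xhat i - xt i)
    rw [sub_sub_cancel] at h2
    have := (hmag i hi).1
    linarith
end
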